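/- Let F be a field, Γ₀ a linearly ordered commutative group with zero, and v : F → Γ₀ a surjective valuation satisfying the triangle condition, and for g ∈ Γ₀ let F_g = {(a,b) ∈ F × F : v(a − b) = g}. Then the complex multiplication of the association scheme {F_g : g ∈ Γ₀} satisfies: F_z ∈ F_x ⋆ F_y if and only if either (x ≠ y and z = max(x, y)) or (x = y and z ≤ x). Consequently this association scheme realizes the linearly ordered hypergroup on Γ₀ in which x * y = {max(x,y)} for x ≠ y and x * x = {z ∈ Γ₀ : z ≤ x}, with identity 0 (this is the multiplicative form of the canonical hypergroup structure on a totally ordered abelian group with adjoined ∞, where x + y = min(x,y) for x ≠ y and x + x = [x, ∞]); hence that hypergroup is realizable. -/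

import Mathlib

universe u v

/-- The diagonal relation `1_X` on a set `X`. -/
def diagRel (X : Type u) : Set (X × X) := {z : X × X | z.1 = z.2}

/-- The transpose `p*` of a binary relation `p`. -/
def transposeRel {X : Type u} (p : Set (X × X)) : Set (X × X) := {z : X × X | (z.2, z.1) ∈ p}

/-- `rels` is an association scheme on `X`: a collection of nonempty relations partitioning
`X × X`, containing the diagonal, closed under transposition, and such that all triangle sets
over a fixed triple of relations are mutually equinumerous. -/
def IsAssocScheme (X : Type u) (rels : Set (Set (X × X))) : Prop :=
  (∀ p ∈ rels, p.Nonempty) ∧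
  (∀ z : X × X, ∃ p ∈ rels, z ∈ p) ∧
  (∀ p ∈ rels, ∀ q ∈ rels, (p ∩ q).Nonempty → p = q) ∧
  diagRel X ∈ rels ∧
  (∀ p ∈ rels, transposeRel p ∈ rels) ∧
  (∀ p ∈ rels, ∀ q ∈ rels, ∀ r ∈ rels, ∀ y z y' z' : X,
    (y, z) ∈ r → (y', z') ∈ r →
    Nonempty ({x : X // (y, x) ∈ p ∧ (x, z) ∈ q} ≃ {x : X // (y', x) ∈ p ∧ (x, z') ∈ q}))

/-- The complex multiplication `p ⋆ q` of two relations of an association scheme `rels`: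
`r ∈ p ⋆ q` iff `r ∈ rels` and there are `(y, z) ∈ r` and `x` with `(y, x) ∈ p`, `(x, z) ∈ q`. -/
def cmul {X : Type u} (rels : Set (Set (X × X))) (p q : Set (X × X)) : Set (Set (X × X)) :=
  {r ∈ rels | ∃ y x z : X, (y, z) ∈ r ∧ (y, x) ∈ p ∧ (x, z) ∈ q}
/-- A hypergroup: a multivalued operation with nonempty values, associative on subsets,
with a unique two-sided identity, unique inverses, and reversibility. -/
structure Hypergroup (H : Type u) where
  mul : H → H → Set H
  nonempty_mul : ∀ a b : H, (mul a b).Nonempty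
  e : H
  inv : H → H
  assoc : ∀ a b c : H, (⋃ x ∈ mul a b, mul x c) = ⋃ y ∈ mul b c, mul a y
  e_mul : ∀ a : H, mul e a = {a}
  mul_e : ∀ a : H, mul a e = {a}
  e_unique : ∀ e' : H, (∀ a : H, mul e' a = {a} ∧ mul a e' = {a}) → e' = e
  mem_inv_mul : ∀ a : H, e ∈ mul (inv a) a
  mem_mul_inv : ∀ a : H, e ∈ mul a (inv a)
  inv_unique : ∀ a b : H, e ∈ mul b a → e ∈ mul a b → b = inv a
  rev_left : ∀ a b c : H, c ∈ mul a b → a ∈ mul c (inv b)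
  rev_right : ∀ a b c : H, c ∈ mul a b → b ∈ mul (inv a) c
/-- A hypergroup `(H, *)` is realizable if there are a nonempty set `X`, an association
scheme on `X`, and a bijection `φ` from the scheme to `H` transporting complex
multiplication to the hyperoperation. -/
def IsRealizable {H : Type u} (hyp : Hypergroup H) : Prop :=
  ∃ (X : Type u) (_ : Nonempty X) (rels : Set (Set (X × X))),
    IsAssocScheme X rels ∧
    ∃ φ : {p : Set (X × X) // p ∈ rels} → H, Function.Bijective φ ∧
      ∀ p q r : {p : Set (X × X) // p ∈ rels},
        (r : Set (X × X)) ∈ cmul rels (p : Set (X × X)) (q : Set (X × X)) ↔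
          φ r ∈ hyp.mul (φ p) (φ q)

/-- A hypergroup is finitely realizable if it is realizable over a finite set `X`. -/
def IsFinitelyRealizable {H : Type u} (hyp : Hypergroup H) : Prop :=
  ∃ (X : Type u) (_ : Nonempty X) (_ : Finite X) (rels : Set (Set (X × X))),
    IsAssocScheme X rels ∧
    ∃ φ : {p : Set (X × X) // p ∈ rels} → H, Function.Bijective φ ∧
      ∀ p q r : {p : Set (X × X) // p ∈ rels},
        (r : Set (X × X)) ∈ cmul rels (p : Set (X × X)) (q : Set (X × X)) ↔
          φ r ∈ hyp.mul (φ p) (φ q)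
/-- The triangle condition for a valuation `v` (multiplicative convention): for any two pairs
at the same "distance" `r = v(a−b) = v(a'−b')`, the two sets of apexes of isoceles triangles
over them with both legs of distance `r` are nonempty and equinumerous. -/
def TriangleCond {F : Type u} {Γ₀ : Type v} [Field F] [LinearOrderedCommGroupWithZero Γ₀]
    (v : Valuation F Γ₀) : Prop :=
  ∀ a b a' b' : F, v (a - b) = v (a' - b') →
    ({y : F | v (a - y) = v (a - b) ∧ v (y - b) = v (a - b)}).Nonempty ∧
    Nonempty ({y : F // v (a - y) = v (a - b) ∧ v (y - b) = v (a - b)} ≃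
      {y : F // v (a' - y) = v (a' - b') ∧ v (y - b') = v (a' - b')})

/-- The relation `F_g = {(a, b) : v(a − b) = g}` on `F` associated to a value `g ∈ Γ₀`. -/
def valRel {F : Type u} {Γ₀ : Type v} [Field F] [LinearOrderedCommGroupWithZero Γ₀]
    (v : Valuation F Γ₀) (g : Γ₀) : Set (F × F) :=
  {z | v (z.1 - z.2) = g}

section ValuationScheme

variable {F : Type u} {Γ₀ : Type v} [Field F] [LinearOrderedCommGroupWithZero Γ₀]
  {v : Valuation F Γ₀}

theorem mem_valRel {g : Γ₀} {a b : F} : (a, b) ∈ valRel v g ↔ v (a - b) = g := Iff.rfl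

theorem valRel_nonempty (hsurj : Function.Surjective v) (g : Γ₀) : (valRel v g).Nonempty := by
  obtain ⟨a, rfl⟩ := hsurj g
  exact ⟨(a, 0), by simp [mem_valRel]⟩

theorem valRel_injective (hsurj : Function.Surjective v) : Function.Injective (valRel v) := by
  intro g h hgh
  obtain ⟨⟨a, b⟩, hab⟩ := valRel_nonempty hsurj g
  have hab' : (a, b) ∈ valRel v h := hgh ▸ hab
  exact (mem_valRel.1 hab).symm.trans (mem_valRel.1 hab')

/-- Two differences of equal value agree up to a factor of value `1`. -/
theorem exists_val_one_mul_eq {s t : F} (h : v s = v t) : ∃ c : F, v c = 1 ∧ t = c * s := by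
  by_cases hs : s = 0
  · refine ⟨1, map_one v, ?_⟩
    have ht : t = 0 := by rw [← v.zero_iff, ← h, hs, map_zero]
    simp [hs, ht]
  · have hvs : v s ≠ 0 := v.ne_zero_iff.2 hs
    exact ⟨t / s, by rw [map_div₀, ← h, div_self hvs], (div_mul_cancel₀ t hs).symm⟩

/-- An affine map of ratio of value `1` matches the triangle sets over two pairs at the same
distance. -/
theorem nonempty_triangle_equiv (x y : Γ₀) {a b a' b' : F} (h : v (a - b) = v (a' - b')) :
    Nonempty ({t : F // v (a - t) = x ∧ v (t - b) = y} ≃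
      {t : F // v (a' - t) = x ∧ v (t - b') = y}) := by
  obtain ⟨c, hc, hab⟩ := exists_val_one_mul_eq h
  have hc0 : c ≠ 0 := v.ne_zero_iff.1 (by simp [hc])
  let e : F ≃ F :=
    ((Equiv.subLeft a).trans (Equiv.mulRight₀ c hc0)).trans (Equiv.subLeft a')
  refine ⟨e.subtypeEquiv fun t => ?_⟩
  have he : e t = a' - (a - t) * c := rfl
  have h₁ : a' - e t = (a - t) * c := by rw [he]; ring
  have h₂ : e t - b' = (t - b) * c := by rw [he]; linear_combination hab
  rw [h₁, h₂, map_mul, map_mul, hc, mul_one, mul_one]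

theorem isAssocScheme_valRel (hsurj : Function.Surjective v) :
    IsAssocScheme F {R | ∃ g : Γ₀, R = valRel v g} := by
  refine ⟨?_, fun z => ⟨_, ⟨v (z.1 - z.2), rfl⟩, rfl⟩, ?_, ⟨0, ?_⟩, ?_, ?_⟩
  · rintro _ ⟨g, rfl⟩
    exact valRel_nonempty hsurj g
  · rintro _ ⟨g, rfl⟩ _ ⟨h, rfl⟩ ⟨z, hg, hh⟩
    exact congrArg (valRel v) (Eq.trans (Eq.symm hg) hh)
  · ext ⟨a, b⟩
    simp [diagRel, valRel, sub_eq_zero]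
  · rintro _ ⟨g, rfl⟩
    refine ⟨g, ?_⟩
    ext ⟨a, b⟩
    simp [transposeRel, valRel, v.map_sub_swap a b]
  · rintro _ ⟨x, rfl⟩ _ ⟨y, rfl⟩ _ ⟨z, rfl⟩ a b a' b' h h'
    exact nonempty_triangle_equiv x y ((mem_valRel.1 h).trans (mem_valRel.1 h').symm)

theorem valRel_mem_cmul_iff_exists (x y z : Γ₀) :
    valRel v z ∈ cmul {R | ∃ g : Γ₀, R = valRel v g} (valRel v x) (valRel v y) ↔
      ∃ s t : F, v s = x ∧ v t = y ∧ v (s + t) = z := by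
  constructor
  · rintro ⟨-, a, t, b, hz, hx, hy⟩
    refine ⟨a - t, t - b, hx, hy, ?_⟩
    rw [sub_add_sub_cancel]
    exact hz
  · rintro ⟨s, t, hs, ht, hst⟩
    exact ⟨⟨z, rfl⟩, s + t, t, 0, by simpa [mem_valRel], by simpa [mem_valRel],
      by simpa [mem_valRel]⟩

theorem valRel_mem_cmul_iff (hsurj : Function.Surjective v) (htri : TriangleCond v)
    (x y z : Γ₀) :
    valRel v z ∈ cmul {R | ∃ g : Γ₀, R = valRel v g} (valRel v x) (valRel v y) ↔
      ((x ≠ y ∧ z = max x y) ∨ (x = y ∧ z ≤ x)) := by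
  rw [valRel_mem_cmul_iff_exists]
  constructor
  · rintro ⟨s, t, rfl, rfl, rfl⟩
    by_cases h : v s = v t
    · exact Or.inr ⟨h, (v.map_add s t).trans (by rw [h, max_self])⟩
    · exact Or.inl ⟨h, v.map_add_of_distinct_val h⟩
  · rintro (⟨hne, rfl⟩ | ⟨rfl, hz⟩)
    · obtain ⟨s, rfl⟩ := hsurj x
      obtain ⟨t, rfl⟩ := hsurj y
      exact ⟨s, t, rfl, rfl, v.map_add_of_distinct_val hne⟩
    · obtain ⟨s, rfl⟩ := hsurj x
      obtain ⟨t, rfl⟩ := hsurj z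
      rcases hz.eq_or_lt with heq | hlt
      · obtain ⟨w, hw₁, hw₂⟩ := (htri t 0 t 0 rfl).1
        rw [sub_zero] at hw₁ hw₂
        rw [sub_zero] at hw₂
        exact ⟨t - w, w, hw₁.trans heq, hw₂.trans heq, by rw [sub_add_cancel]⟩
      · refine ⟨t - s, s, ?_, rfl, by rw [sub_add_cancel]⟩
        rw [v.map_sub_swap, v.map_sub_eq_of_lt_left hlt]

end ValuationScheme

/-- For a surjective valuation `v : F → Γ₀` satisfying the triangle
condition, the complex multiplication of the association scheme `{F_g : g ∈ Γ₀}` satisfies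
`F_z ∈ F_x ⋆ F_y` iff (`x ≠ y` and `z = max x y`) or (`x = y` and `z ≤ x`). Consequently this
scheme realizes the linearly ordered hypergroup on `Γ₀` with `x * y = {max x y}` for `x ≠ y`,
`x * x = {z : z ≤ x}`, and identity `0` (the multiplicative form of the canonical hypergroup
on a totally ordered abelian group with `∞` adjoined); hence that hypergroup is realizable. -/
theorem valuation_scheme_realizes_linear_hypergroup {F Γ₀ : Type u}
    [Field F] [LinearOrderedCommGroupWithZero Γ₀]
    (v : Valuation F Γ₀) (hsurj : Function.Surjective v) (htri : TriangleCond v)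
    (hyp : Hypergroup Γ₀)
    (hmul_eq : ∀ x : Γ₀, hyp.mul x x = {z : Γ₀ | z ≤ x})
    (hmul_ne : ∀ x y : Γ₀, x ≠ y → hyp.mul x y = {max x y})
    (he : hyp.e = 0) :
    (∀ x y z : Γ₀,
      valRel v z ∈ cmul {R | ∃ g : Γ₀, R = valRel v g} (valRel v x) (valRel v y) ↔
        ((x ≠ y ∧ z = max x y) ∨ (x = y ∧ z ≤ x))) ∧
    IsRealizable hyp := by
  have hcmul := valRel_mem_cmul_iff hsurj htri
  refine ⟨hcmul, F, ⟨0⟩, {R | ∃ g : Γ₀, R = valRel v g}, isAssocScheme_valRel hsurj, ?_⟩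
  let ψ : Γ₀ → {R : Set (F × F) // R ∈ {R | ∃ g : Γ₀, R = valRel v g}} :=
    fun g => ⟨valRel v g, g, rfl⟩
  have hψ : Function.Bijective ψ :=
    ⟨fun g h hgh => valRel_injective hsurj (congrArg Subtype.val hgh),
      fun ⟨_, g, hg⟩ => ⟨g, Subtype.ext hg.symm⟩⟩
  let e := Equiv.ofBijective ψ hψ
  refine ⟨e.symm, e.symm.bijective, fun p q r => ?_⟩
  obtain ⟨x, rfl⟩ := e.surjective p
  obtain ⟨y, rfl⟩ := e.surjective q
  obtain ⟨z, rfl⟩ := e.surjective r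
  rw [e.symm_apply_apply, e.symm_apply_apply, e.symm_apply_apply]
  refine (hcmul x y z).trans ?_
  by_cases h : x = y
  · subst h
    simp [hmul_eq]
  · simp [hmul_ne x y h, h]
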